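/- Let δ > 1. The weight w(t) = t^{δ−1} on [0,1] belongs to RH_∞^δ([0,1]), and for every q with 1 < q ≤ δ one has ∫_0^1 w(t)^{1−q'} dt = ∞; in particular sup_{J ⊂ [0,1]} ⟨w⟩_J ⟨w^{1−q'}⟩_J^{q−1} = ∞, so no finite A_q constant holds for the whole class RH_∞^δ when q ≤ δ. -/

import Mathlib

open MeasureTheory Set ENNReal

/-- The average `⟨f⟩_{(a,b)}` of an `ℝ≥0∞`-valued function over an interval. -/
noncomputable def avgE (f : ℝ → ℝ≥0∞) (a b : ℝ) : ℝ≥0∞ :=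
  (∫⁻ t in Set.Ioo a b, f t) / ENNReal.ofReal (b - a)

/-- `w ∈ RH_∞^δ([A,B])`: on every subinterval, `ess sup w ≤ δ ⟨w⟩`. -/
def MemRHinf (δ A B : ℝ) (w : ℝ → ℝ≥0∞) : Prop :=
  Measurable w ∧ (∫⁻ t in Set.Ioo A B, w t) ≠ ⊤ ∧
    ∀ a b, A ≤ a → a < b → b ≤ B →
      essSup w (volume.restrict (Set.Ioo a b)) ≤ ENNReal.ofReal δ * avgE w a b

/-- The lower Lebesgue integral of `t ^ s` over an interval in `[0, ∞)`, for `s ≥ 0`. -/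
theorem lintegral_Ioo_ofReal_rpow {s a b : ℝ} (hs : 0 ≤ s) (ha : 0 ≤ a) (hab : a ≤ b) :
    ∫⁻ t in Ioo a b, ENNReal.ofReal (t ^ s) =
      ENNReal.ofReal ((b ^ (s + 1) - a ^ (s + 1)) / (s + 1)) := by
  rw [← integral_rpow (Or.inl (by linarith)), intervalIntegral.integral_of_le hab,
    integral_Ioc_eq_integral_Ioo, ofReal_integral_eq_lintegral_ofReal]
  · exact ((intervalIntegrable_iff_integrableOn_Ioo_of_le hab).1
      (intervalIntegral.intervalIntegrable_rpow' (by linarith)))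
  · filter_upwards [ae_restrict_mem measurableSet_Ioo] with t ht
    exact Real.rpow_nonneg (ha.trans ht.1.le) _

/-- `t ^ s` is not integrable at the origin for `s ≤ -1`. -/
theorem lintegral_Ioo_ofReal_rpow_eq_top {s b : ℝ} (hs : s ≤ -1) (hb : 0 < b) :
    ∫⁻ t in Ioo 0 b, ENNReal.ofReal (t ^ s) = ⊤ := by
  by_contra h
  have hint : IntegrableOn (fun t : ℝ => t ^ s) (Ioo 0 b) := by
    refine (lintegral_ofReal_ne_top_iff_integrable
      (measurable_id.pow_const s).aestronglyMeasurable ?_).1 h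
    filter_upwards [ae_restrict_mem measurableSet_Ioo] with t ht
    exact Real.rpow_nonneg ht.1.le _
  rw [intervalIntegral.integrableOn_Ioo_rpow_iff hb] at hint
  linarith

/-- The power weight `t ^ (δ - 1)` satisfies the `RH_∞` condition on `[0, 1]` with constant `δ`. -/
theorem memRHinf_rpow {δ : ℝ} (hδ : 1 < δ) :
    MemRHinf δ 0 1 (fun t => ENNReal.ofReal (t ^ (δ - 1))) := by
  have hs : 0 ≤ δ - 1 := by linarith
  refine ⟨(measurable_id.pow_const (δ - 1)).ennreal_ofReal, ?_, fun a b ha hab _ => ?_⟩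
  · rw [lintegral_Ioo_ofReal_rpow hs le_rfl zero_le_one]
    exact ENNReal.ofReal_ne_top
  · have hb : 0 < b := ha.trans_lt hab
    have hba : 0 < b - a := sub_pos.2 hab
    have hpow : ∀ x : ℝ, 0 ≤ x → x ^ δ = x * x ^ (δ - 1) := fun x hx => by
      rw [← Real.rpow_one_add' hx (by linarith), add_sub_cancel]
    have hmono : a ^ (δ - 1) ≤ b ^ (δ - 1) := Real.rpow_le_rpow ha hab.le hs
    calc essSup (fun t => ENNReal.ofReal (t ^ (δ - 1))) (volume.restrict (Ioo a b))
        ≤ ENNReal.ofReal (b ^ (δ - 1)) := by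
          refine essSup_le_of_ae_le _ ?_
          filter_upwards [ae_restrict_mem measurableSet_Ioo] with t ht
          exact ENNReal.ofReal_le_ofReal
            (Real.rpow_le_rpow (ha.trans ht.1.le) ht.2.le hs)
      _ ≤ ENNReal.ofReal (δ * ((b ^ δ - a ^ δ) / δ / (b - a))) := by
          refine ENNReal.ofReal_le_ofReal ?_
          rw [← mul_div_assoc, mul_div_cancel₀ _ (by linarith : δ ≠ 0), le_div_iff₀ hba,
            hpow a ha, hpow b hb.le]
          nlinarith [mul_le_mul_of_nonneg_left hmono ha]
      _ = ENNReal.ofReal δ * avgE (fun t => ENNReal.ofReal (t ^ (δ - 1))) a b := by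
          rw [avgE, lintegral_Ioo_ofReal_rpow hs ha hab.le, sub_add_cancel,
            ENNReal.ofReal_mul (by linarith), ENNReal.ofReal_div_of_pos hba]

theorem statement6 (δ : ℝ) (hδ : 1 < δ) :
    MemRHinf δ 0 1 (fun t => ENNReal.ofReal (t ^ (δ - 1))) ∧
    ∀ q : ℝ, 1 < q → q ≤ δ →
      (∫⁻ t in Set.Ioo (0:ℝ) 1,
          (ENNReal.ofReal (t ^ (δ - 1))) ^ (1 - q / (q - 1))) = ⊤ ∧
      sSup { y : ℝ≥0∞ | ∃ a b : ℝ, 0 ≤ a ∧ a < b ∧ b ≤ 1 ∧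
          y = avgE (fun t => ENNReal.ofReal (t ^ (δ - 1))) a b *
              (avgE (fun t => (ENNReal.ofReal (t ^ (δ - 1))) ^ (1 - q / (q - 1)))
                a b) ^ (q - 1) } = ⊤ := by
  refine ⟨memRHinf_rpow hδ, fun q hq hqδ => ?_⟩
  have hq0 : 0 < q - 1 := sub_pos.2 hq
  have hexp : (δ - 1) * (1 - q / (q - 1)) ≤ -1 := by
    have h : (δ - 1) * (1 - q / (q - 1)) = -((δ - 1) / (q - 1)) := by
      field_simp
      ring
    rw [h, neg_le_neg_iff, one_le_div hq0]
    linarith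
  have htop : (∫⁻ t in Ioo (0 : ℝ) 1,
      (ENNReal.ofReal (t ^ (δ - 1))) ^ (1 - q / (q - 1))) = ⊤ := by
    rw [← lintegral_Ioo_ofReal_rpow_eq_top hexp one_pos]
    refine setLIntegral_congr_fun measurableSet_Ioo fun t ht => ?_
    rw [ENNReal.ofReal_rpow_of_pos (Real.rpow_pos_of_pos ht.1 _), ← Real.rpow_mul ht.1.le]
  refine ⟨htop, top_le_iff.1 (le_sSup ⟨0, 1, le_rfl, one_pos, le_rfl, ?_⟩)⟩
  have hw : avgE (fun t => ENNReal.ofReal (t ^ (δ - 1))) 0 1 ≠ 0 := by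
    rw [avgE, lintegral_Ioo_ofReal_rpow (by linarith) le_rfl zero_le_one, sub_add_cancel,
      Real.one_rpow, Real.zero_rpow (by linarith)]
    simp only [sub_zero, ENNReal.ofReal_one, div_one]
    exact (ENNReal.ofReal_pos.2 (by positivity)).ne'
  have hdual : avgE (fun t => (ENNReal.ofReal (t ^ (δ - 1))) ^ (1 - q / (q - 1))) 0 1 = ⊤ := by
    rw [avgE, htop, sub_zero, ENNReal.ofReal_one, div_one]
  rw [hdual, ENNReal.top_rpow_of_pos hq0, ENNReal.mul_top hw]
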